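/- arXiv:1510.00318 — 2 statements merged into one kernel-verified Lean document; each statement's English description precedes it below -/
import Mathlib

section
/- In H[Z_5], the set {F_n : n ∈ ℕ} of Fibonacci quaternions contains exactly 4 zero divisors and exactly 16 units. -/
open Quaternion

/-- The n-th Fibonacci quaternion over a commutative ring `R`:
`F_n = f_n + f_{n+1}·i + f_{n+2}·j + f_{n+3}·k` in `ℍ[R] = H(-1,-1)`. -/
def fibQuat (R : Type*) [CommRing R] (n : ℕ) : ℍ[R] :=
  ⟨(Nat.fib n : R), (Nat.fib (n + 1) : R), (Nat.fib (n + 2) : R), (Nat.fib (n + 3) : R)⟩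

theorem Quaternion.isUnit_iff_isUnit_normSq {R : Type*} [CommRing R] (a : ℍ[R]) :
    IsUnit a ↔ IsUnit (normSq a) := by
  refine ⟨fun h => h.map normSq, fun h => ?_⟩
  have h' : IsUnit (a * star a) := by
    rw [self_mul_star]
    exact h.map (algebraMap R ℍ[R])
  have hcomm : Commute a (star a) := by
    rw [commute_iff_eq, self_mul_star, star_mul_self]
  exact (hcomm.isUnit_mul_iff.mp h').1

theorem Nat.fib_cast_zmod_five_periodic :
    Function.Periodic (fun n => (Nat.fib n : ZMod 5)) 20 := by
  intro n
  have h : Nat.fib (n + 20) = Nat.fib n * Nat.fib 19 + Nat.fib (n + 1) * Nat.fib 20 :=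
    Nat.fib_add n 19
  have h19 : (Nat.fib 19 : ZMod 5) = 1 := by decide
  have h20 : (Nat.fib 20 : ZMod 5) = 0 := by decide
  simp only [h, Nat.cast_add, Nat.cast_mul, h19, h20, mul_one, mul_zero, add_zero]

theorem fibQuat_zmod_five_periodic : Function.Periodic (fibQuat (ZMod 5)) 20 := by
  intro n
  have h (k : ℕ) : (Nat.fib (n + 20 + k) : ZMod 5) = Nat.fib (n + k) := by
    rw [add_right_comm]
    exact Nat.fib_cast_zmod_five_periodic (n + k)
  exact QuaternionAlgebra.ext (h 0) (h 1) (h 2) (h 3)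

theorem fibQuat_zmod_five_injOn :
    Set.InjOn (fibQuat (ZMod 5)) (Finset.range 20) := by
  have key : ∀ m ∈ Finset.range 20, ∀ n ∈ Finset.range 20,
      (Nat.fib m : ZMod 5) = Nat.fib n →
        (Nat.fib (m + 1) : ZMod 5) = Nat.fib (n + 1) → m = n := by decide
  intro m hm n hn h
  exact key m hm n hn (congrArg QuaternionAlgebra.re h) (congrArg QuaternionAlgebra.imI h)

theorem isUnit_fibQuat_zmod_five_iff {n : ℕ} (hn : n ∈ Finset.range 20) :
    IsUnit (fibQuat (ZMod 5) n) ↔ n % 5 ≠ 1 := by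
  have key : ∀ m ∈ Finset.range 20,
      (Nat.fib m : ZMod 5) ^ 2 + (Nat.fib (m + 1) : ZMod 5) ^ 2 + (Nat.fib (m + 2) : ZMod 5) ^ 2 +
        (Nat.fib (m + 3) : ZMod 5) ^ 2 ≠ 0 ↔ m % 5 ≠ 1 := by decide
  have : Fact (Nat.Prime 5) := ⟨by norm_num⟩
  rw [Quaternion.isUnit_iff_isUnit_normSq, isUnit_iff_ne_zero, normSq_def']
  exact key n hn

theorem ncard_sep_range_fibQuat_zmod_five (P : ℍ[ZMod 5] → Prop) (p : ℕ → Prop) [DecidablePred p]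
    (h : ∀ n ∈ Finset.range 20, P (fibQuat (ZMod 5) n) ↔ p n) :
    {x ∈ Set.range (fibQuat (ZMod 5)) | P x}.ncard = ((Finset.range 20).filter p).card := by
  have himage : {x ∈ Set.range (fibQuat (ZMod 5)) | P x} =
      fibQuat (ZMod 5) '' ((Finset.range 20).filter p : Finset ℕ) := by
    ext x
    constructor
    · rintro ⟨⟨n, rfl⟩, hP⟩
      have hmod := fibQuat_zmod_five_periodic.map_mod_nat n
      have hmem : n % 20 ∈ Finset.range 20 := Finset.mem_range.mpr (Nat.mod_lt _ (by norm_num))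
      exact ⟨n % 20, Finset.mem_filter.mpr ⟨hmem, (h _ hmem).mp (hmod ▸ hP)⟩, hmod⟩
    · rintro ⟨n, hn, rfl⟩
      obtain ⟨hmem, hp⟩ := Finset.mem_filter.mp hn
      exact ⟨⟨n, rfl⟩, (h n hmem).mpr hp⟩
  have hinj := fibQuat_zmod_five_injOn.mono (Finset.coe_subset.mpr (Finset.filter_subset p _))
  rw [himage, hinj.ncard_image, Set.ncard_coe_finset]

theorem fibQuat_zmod_five_count :
    {x ∈ Set.range (fibQuat (ZMod 5)) | ¬ IsUnit x}.ncard = 4 ∧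
    {x ∈ Set.range (fibQuat (ZMod 5)) | IsUnit x}.ncard = 16 := by
  constructor
  · rw [ncard_sep_range_fibQuat_zmod_five _ (fun n => ¬ n % 5 ≠ 1)
      fun n hn => not_congr (isUnit_fibQuat_zmod_five_iff hn)]
    decide
  · rw [ncard_sep_range_fibQuat_zmod_five _ (fun n => n % 5 ≠ 1)
      fun n hn => isUnit_fibQuat_zmod_five_iff hn]
    decide
end

section
/- Let p be a prime with p ≡ 13 (mod 20) or p ≡ 17 (mod 20), let l ≥ 1 be an integer, and let n be the natural number determined by 4·(n + 1) = (2l + 1)·p + 2l − 1 (this quantity is divisible by 4). Then the Fibonacci quaternion F_n is a zero divisor in H[Z_p] (equivalently, F_n is not a unit). -/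
open Quaternion

theorem normSq_fibQuat (R : Type*) [CommRing R] (n : ℕ) :
    normSq (fibQuat R n) = 3 * (Nat.fib (2 * n + 3) : R) := by
  have h : Nat.fib (2 * n + 3) = Nat.fib (n + 2) ^ 2 + Nat.fib (n + 1) ^ 2 :=
    Nat.fib_two_mul_add_one (n + 1)
  rw [normSq_def', h]
  simp only [fibQuat, Nat.fib_add_two (n := n + 1), Nat.fib_add_two (n := n)]
  push_cast
  ring

/-- Binet's formula, for a square root `s` of `5` in any field where `2` is invertible. -/
theorem fib_mul_eq_pow_sub_pow {K : Type*} [Field K] (h2 : (2 : K) ≠ 0) {s : K}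
    (hs : s ^ 2 = 5) (n : ℕ) :
    (Nat.fib n : K) * s = ((1 + s) / 2) ^ n - ((1 - s) / 2) ^ n := by
  have hx : ((1 + s) / 2) ^ 2 = (1 + s) / 2 + 1 := by
    field_simp
    linear_combination hs
  have hy : ((1 - s) / 2) ^ 2 = (1 - s) / 2 + 1 := by
    field_simp
    linear_combination hs
  induction n using Nat.twoStepInduction with
  | zero => simp
  | one =>
    field_simp
    simp
    ring
  | more n ih₁ ih₂ =>
    rw [Nat.fib_add_two, pow_add _ n 2, pow_add _ n 2, hx, hy]
    push_cast
    linear_combination ih₁ + ih₂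

theorem dvd_fib_half_succ_of_pow_eq_neg {p : ℕ} [Fact p.Prime] (hp4 : p % 4 = 1)
    {K : Type*} [Field K] [CharP K p] {s : K} (hs : s ^ 2 = 5) (hs0 : s ≠ 0)
    (hsp : s ^ p = -s) : p ∣ Nat.fib ((p + 1) / 2) := by
  have h2 : (2 : K) ≠ 0 := by
    intro h
    have : p ∣ 2 := (CharP.cast_eq_zero_iff K p 2).1 (by exact_mod_cast h)
    have := Nat.le_of_dvd two_pos this
    have := (Fact.out : p.Prime).two_le
    omega
  have h2p : (2 : K) ^ p = 2 := by
    rw [← one_add_one_eq_two, add_pow_char, one_pow]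
  have hxp : ((1 + s) / 2) ^ p = (1 - s) / 2 := by
    rw [div_pow, add_pow_char, h2p, hsp, one_pow, sub_eq_add_neg]
  have hxy : (1 + s) / 2 * ((1 - s) / 2) = -1 := by
    field_simp
    linear_combination -hs
  have hx0 : (1 + s) / 2 ≠ 0 := by
    intro h
    simp [h] at hxy
  have hodd : Odd ((p + 1) / 2) := Nat.odd_iff.2 (by omega)
  have hpows : ((1 + s) / 2) ^ ((p + 1) / 2) = ((1 - s) / 2) ^ ((p + 1) / 2) := by
    apply mul_left_cancel₀ (pow_ne_zero ((p + 1) / 2) hx0)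
    rw [← pow_add, ← mul_pow ((1 + s) / 2) ((1 - s) / 2), hxy, hodd.neg_one_pow,
      show (p + 1) / 2 + (p + 1) / 2 = p + 1 by omega, pow_succ, hxp, mul_comm, hxy]
  have hfib := fib_mul_eq_pow_sub_pow h2 hs ((p + 1) / 2)
  rw [hpows, sub_self] at hfib
  exact (CharP.cast_eq_zero_iff K p _).1 ((mul_eq_zero.1 hfib).resolve_right hs0)

/-- If `p ≡ 1 [MOD 4]` is a prime modulo which `5` is not a square, then `p ∣ fib ((p + 1) / 2)`. -/
theorem dvd_fib_half_succ {p : ℕ} [Fact p.Prime] (hp4 : p % 4 = 1)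
    (h5 : ¬ IsSquare (5 : ZMod p)) : p ∣ Nat.fib ((p + 1) / 2) := by
  have h50 : (5 : ZMod p) ≠ 0 := fun h => h5 (h ▸ IsSquare.zero)
  have hpow : (5 : ZMod p) ^ (p / 2) = -1 :=
    (ZMod.pow_div_two_eq_neg_one_or_one p h50).resolve_left
      fun h => h5 ((ZMod.euler_criterion p h50).2 h)
  have hmap : algebraMap (ZMod p) (AlgebraicClosure (ZMod p)) 5 = 5 := map_ofNat _ 5
  obtain ⟨s, hs⟩ := IsAlgClosed.exists_pow_nat_eq
    (5 : AlgebraicClosure (ZMod p)) two_pos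
  have hs0 : s ≠ 0 := by
    rintro rfl
    refine h50 ((map_eq_zero (algebraMap (ZMod p) (AlgebraicClosure (ZMod p)))).1 ?_)
    rw [hmap, ← hs, zero_pow two_ne_zero]
  have hsp : s ^ p = -s := by
    have hp : s ^ p = s ^ (2 * (p / 2) + 1) := congrArg (s ^ ·) (by omega)
    rw [hp, pow_succ, pow_mul, hs, ← hmap, ← map_pow, hpow, map_neg, map_one, neg_one_mul]
  have : CharP (AlgebraicClosure (ZMod p)) p :=
    charP_of_injective_algebraMap (algebraMap (ZMod p) _).injective p
  exact dvd_fib_half_succ_of_pow_eq_neg hp4 hs hs0 hsp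

theorem not_isSquare_five {p : ℕ} [Fact p.Prime] (hmod : p % 20 = 13 ∨ p % 20 = 17) :
    ¬ IsSquare (5 : ZMod p) := by
  have h3 : ¬ IsSquare ((3 : ℕ) : ZMod 5) := by decide
  have h2 : ¬ IsSquare ((2 : ℕ) : ZMod 5) := by decide
  have : Fact (Nat.Prime 5) := ⟨by norm_num⟩
  have hrec := ZMod.exists_sq_eq_prime_iff_of_mod_four_eq_one (p := 5) (q := p)
    (by norm_num) (by omega)
  intro h
  have h' := hrec.2 (by exact_mod_cast h)
  rw [← ZMod.natCast_mod p 5] at h'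
  have hr : p % 5 = 3 ∨ p % 5 = 2 := by omega
  rcases hr with hr | hr <;> rw [hr] at h'
  · exact h3 h'
  · exact h2 h'

theorem fibQuat_zeroDivisor_of_mod_twenty (p : ℕ) (hp : p.Prime)
    (hmod : p % 20 = 13 ∨ p % 20 = 17) (l : ℕ) (hl : 1 ≤ l) (n : ℕ)
    (hn : 4 * (n + 1) = (2 * l + 1) * p + 2 * l - 1) :
    ¬ IsUnit (fibQuat (ZMod p) n) := by
  have : Fact p.Prime := ⟨hp⟩
  have hidx : 2 * n + 3 = (2 * l + 1) * ((p + 1) / 2) := by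
    obtain ⟨m, rfl⟩ : ∃ m, p = 2 * m + 1 := ⟨p / 2, by omega⟩
    rw [show (2 * m + 1 + 1) / 2 = m + 1 by omega]
    ring_nf at hn ⊢
    omega
  have hdvd : p ∣ Nat.fib (2 * n + 3) :=
    (dvd_fib_half_succ (by omega) (not_isSquare_five hmod)).trans
      (Nat.fib_dvd _ _ (hidx ▸ dvd_mul_left _ _))
  intro hunit
  have hnorm := hunit.map (normSq : ℍ[ZMod p] →*₀ ZMod p)
  rw [normSq_fibQuat, (ZMod.natCast_eq_zero_iff _ _).2 hdvd, mul_zero] at hnorm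
  exact not_isUnit_zero hnorm
end
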